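/- Let B > 0 and A, C be real constants with A ≠ 0, let r₀ > 0, and suppose r⁴ + C·√(1+Br²) + A > 0 for all r > r₀; set f(r) = √(1 + (C·√(1+Br²) + A)/r⁴) and h(r) = √(1+Br²)·f(r) on (r₀, ∞). Let v : (r₀, ∞) → ℝ be twice differentiable, not identically zero, and satisfy for all r > r₀ both h(r)²·v''(r) − (h(r)²/r + f'(r)h(r)²/f(r) − h'(r)h(r))·v'(r) = 0 and (f'(r)h(r)²/f(r))·v'(r) = −(2AB/r⁴)·v(r). Then C = 0 and there exists a real constant C₁ ≠ 0 such that v(r) = C₁·√(1+Br²) for all r > r₀. -/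

import Mathlib

/-- A function with vanishing derivative on an open half-line is constant there. -/
lemma exists_eq_const_of_hasDerivAt_zero_Ioi {g : ℝ → ℝ} {a : ℝ}
    (hg : ∀ r, a < r → HasDerivAt g 0 r) : ∃ k, ∀ r, a < r → g r = k :=
  isOpen_Ioi.exists_is_const_of_deriv_eq_zero (convex_Ioi a).isPreconnected
    (fun r hr => (hg r hr).differentiableAt.differentiableWithinAt)
    (fun r hr => (hg r hr).deriv)

lemma hasDerivAt_sqrt_one_add_mul_sq {B r : ℝ} (hB : 0 < B) :
    HasDerivAt (fun r => Real.sqrt (1 + B * r ^ 2)) (B * r / Real.sqrt (1 + B * r ^ 2)) r := by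
  have hP : 0 < 1 + B * r ^ 2 := by positivity
  have hs : 0 < Real.sqrt (1 + B * r ^ 2) := Real.sqrt_pos.2 hP
  refine ((((hasDerivAt_pow 2 r).const_mul B).const_add 1).sqrt hP.ne').congr_deriv ?_
  field_simp
  norm_num

/-- The solutions of `r (1 + B r²) v'' = v'` on a half-line of positive reals are the affine
functions of `√(1 + B r²)`. -/
lemma exists_eq_mul_sqrt_add_const {B r₀ : ℝ} (hB : 0 < B) (hr₀ : 0 ≤ r₀) {v : ℝ → ℝ}
    (hv1 : ∀ r, r₀ < r → DifferentiableAt ℝ v r)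
    (hv2 : ∀ r, r₀ < r → DifferentiableAt ℝ (deriv v) r)
    (hode : ∀ r, r₀ < r → r * (1 + B * r ^ 2) * deriv (deriv v) r = deriv v r) :
    ∃ k c, ∀ r, r₀ < r → v r = k * Real.sqrt (1 + B * r ^ 2) + c ∧
      deriv v r = k * (B * r / Real.sqrt (1 + B * r ^ 2)) := by
  obtain ⟨k, hk⟩ : ∃ k, ∀ r, r₀ < r → deriv v r * Real.sqrt (1 + B * r ^ 2) / r = k := by
    refine exists_eq_const_of_hasDerivAt_zero_Ioi fun r hr => ?_
    have hr0 : 0 < r := hr₀.trans_lt hr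
    have hs : 0 < Real.sqrt (1 + B * r ^ 2) := Real.sqrt_pos.2 (by positivity)
    have hs2 : Real.sqrt (1 + B * r ^ 2) ^ 2 = 1 + B * r ^ 2 := Real.sq_sqrt (by positivity)
    have hd := (((hv2 r hr).hasDerivAt.mul (hasDerivAt_sqrt_one_add_mul_sq (r := r) hB)).div
      (hasDerivAt_id r) hr0.ne')
    refine hd.congr_deriv ?_
    have ho := hode r hr
    simp only [id, Pi.mul_apply]
    generalize Real.sqrt (1 + B * r ^ 2) = s at *
    field_simp
    rw [← hs2] at ho
    linear_combination ho - deriv v r * hs2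
  have hd : ∀ r, r₀ < r → deriv v r = k / B * (B * r / Real.sqrt (1 + B * r ^ 2)) := by
    intro r hr
    have hr0 : 0 < r := hr₀.trans_lt hr
    have hs : 0 < Real.sqrt (1 + B * r ^ 2) := Real.sqrt_pos.2 (by positivity)
    rw [← hk r hr]
    field_simp
  obtain ⟨c, hc⟩ : ∃ c, ∀ r, r₀ < r → v r - k / B * Real.sqrt (1 + B * r ^ 2) = c := by
    refine exists_eq_const_of_hasDerivAt_zero_Ioi fun r hr => ?_
    refine ((hv1 r hr).hasDerivAt.sub
      ((hasDerivAt_sqrt_one_add_mul_sq (r := r) hB).const_mul (k / B))).congr_deriv ?_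
    rw [hd r hr, sub_self]
  exact ⟨k / B, c, fun r hr => ⟨by linear_combination hc r hr, hd r hr⟩⟩


/-- analytic core of Theorem 4.4. If A ≠ 0 and a not-identically-zero
twice differentiable v satisfies both
h²·v'' − (h²/r + f'h²/f − h'h)·v' = 0 and (f'h²/f)·v' = −(2AB/r⁴)·v on (r₀,∞),
where f(r) = √(1 + (C√(1+Br²) + A)/r⁴) and h(r) = √(1+Br²)·f(r), then C = 0 and
v = C₁·√(1+Br²) for some constant C₁ ≠ 0. -/
theorem eguchi_hanson_typeII_static_development (B A C : ℝ) (hB : 0 < B)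
    (hA : A ≠ 0) (r₀ : ℝ) (hr₀ : 0 < r₀)
    (hpos : ∀ r : ℝ, r₀ < r → 0 < r ^ 4 + C * Real.sqrt (1 + B * r ^ 2) + A)
    (f h : ℝ → ℝ)
    (hf : ∀ r : ℝ, r₀ < r →
      f r = Real.sqrt (1 + (C * Real.sqrt (1 + B * r ^ 2) + A) / r ^ 4))
    (hh : ∀ r : ℝ, r₀ < r → h r = Real.sqrt (1 + B * r ^ 2) * f r)
    (v : ℝ → ℝ)
    (hv1 : ∀ r : ℝ, r₀ < r → DifferentiableAt ℝ v r)
    (hv2 : ∀ r : ℝ, r₀ < r → DifferentiableAt ℝ (deriv v) r)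
    (hvne : ∃ r : ℝ, r₀ < r ∧ v r ≠ 0)
    (hode1 : ∀ r : ℝ, r₀ < r →
      h r ^ 2 * deriv (deriv v) r
        - (h r ^ 2 / r + deriv f r * h r ^ 2 / f r - deriv h r * h r) * deriv v r
      = 0)
    (hode2 : ∀ r : ℝ, r₀ < r →
      (deriv f r * h r ^ 2 / f r) * deriv v r = -(2 * A * B / r ^ 4) * v r) :
    C = 0 ∧ ∃ C₁ : ℝ, C₁ ≠ 0 ∧ ∀ r : ℝ, r₀ < r →
      v r = C₁ * Real.sqrt (1 + B * r ^ 2) := by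
  have hs : ∀ r, 0 < Real.sqrt (1 + B * r ^ 2) := fun r => Real.sqrt_pos.2 (by positivity)
  have hs2 : ∀ r, Real.sqrt (1 + B * r ^ 2) ^ 2 = 1 + B * r ^ 2 :=
    fun r => Real.sq_sqrt (by positivity)
  have hfpos : ∀ r, r₀ < r → 0 < 1 + (C * Real.sqrt (1 + B * r ^ 2) + A) / r ^ 4 := by
    intro r hr
    have hr0 : 0 < r := hr₀.trans hr
    rw [one_add_div (pow_pos hr0 4).ne', ← add_assoc]
    exact div_pos (hpos r hr) (pow_pos hr0 4)
  have hf0 : ∀ r, r₀ < r → 0 < f r := fun r hr => hf r hr ▸ Real.sqrt_pos.2 (hfpos r hr)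
  have hfd : ∀ r, r₀ < r → HasDerivAt f
      ((C * (B * r / Real.sqrt (1 + B * r ^ 2)) / r ^ 4
        - 4 * (C * Real.sqrt (1 + B * r ^ 2) + A) / r ^ 5) / (2 * f r)) r := by
    intro r hr
    have hr0 : 0 < r := hr₀.trans hr
    have hW := (((((hasDerivAt_sqrt_one_add_mul_sq (r := r) hB).const_mul C).add_const A).div
      (hasDerivAt_pow 4 r) (pow_pos hr0 4).ne').const_add 1).sqrt (hfpos r hr).ne'
    refine (hW.congr_of_eventuallyEq ?_).congr_deriv ?_
    · filter_upwards [Ioi_mem_nhds hr] with x hx using hf x hx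
    · rw [Pi.div_apply, ← hf r hr]
      congr 1
      field_simp
      norm_num
      ring
  have hhd : ∀ r, r₀ < r → deriv h r =
      B * r / Real.sqrt (1 + B * r ^ 2) * f r + Real.sqrt (1 + B * r ^ 2) * deriv f r := by
    intro r hr
    refine HasDerivAt.deriv (((hasDerivAt_sqrt_one_add_mul_sq (r := r) hB).mul
      (hfd r hr).differentiableAt.hasDerivAt).congr_of_eventuallyEq ?_)
    filter_upwards [Ioi_mem_nhds hr] with x hx using hh x hx
  obtain ⟨k, c, hkc⟩ := exists_eq_mul_sqrt_add_const hB hr₀.le hv1 hv2 fun r hr => by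
    have hr0 : 0 < r := hr₀.trans hr
    have ho := hode1 r hr
    rw [hhd r hr, hh r hr] at ho
    have hsr := hs r
    have hs2r := hs2 r
    have hfr := hf0 r hr
    generalize Real.sqrt (1 + B * r ^ 2) = s at *
    field_simp at ho
    refine mul_left_cancel₀ (pow_ne_zero 2 hfr.ne') ?_
    linear_combination ho + f r ^ 2 * (deriv v r - r * deriv (deriv v) r) * hs2r
  have key : ∀ r, r₀ < r → k * C * (3 * (1 + B * r ^ 2) + 1) = 4 * A * c := by
    intro r hr
    have hr0 : 0 < r := hr₀.trans hr
    have ho := hode2 r hr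
    have hfr := hf0 r hr
    rw [(hkc r hr).1, (hkc r hr).2, (hfd r hr).deriv, hh r hr] at ho
    have hsr := hs r
    have hs2r := hs2 r
    generalize Real.sqrt (1 + B * r ^ 2) = s at *
    field_simp at ho
    linear_combination -ho - 4 * k * C * hs2r
  have hkC : k * C = 0 := by
    have h1 := key (r₀ + 1) (by linarith)
    have h2 := key (r₀ + 2) (by linarith)
    have h3 : k * C * (3 * B * (2 * r₀ + 3)) = 0 := by linear_combination h2 - h1
    exact (mul_eq_zero.1 h3).resolve_right (by positivity)
  have hc : c = 0 := by
    have h1 := key (r₀ + 1) (by linarith)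
    rw [hkC, zero_mul] at h1
    exact (mul_eq_zero.1 h1.symm).resolve_left (by positivity)
  have hk : k ≠ 0 := by
    rintro rfl
    obtain ⟨r, hr, hvr⟩ := hvne
    exact hvr (by rw [(hkc r hr).1, hc]; ring)
  exact ⟨(mul_eq_zero.1 hkC).resolve_left hk, k, hk, fun r hr => by
    rw [(hkc r hr).1, hc, add_zero]⟩
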